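/- arXiv:math/0201311 — 2 statements merged into one kernel-verified Lean document; each statement's English description precedes it below -/
import Mathlib

section
/- Every nonzero finitely generated R_f-submodule 𝔄 of K whose multiplier ring {x ∈ K : x·𝔄 ⊆ 𝔄} equals R_f is an invertible fractional R_f-ideal; that is, there exists a nonzero finitely generated R_f-submodule 𝔅 of K with 𝔄·𝔅 = R_f. (This holds because R_f is a Gorenstein ring.) -/
noncomputable section
open Complex Pointwise

/-- `√−2 = i·√2` -/
def sm2 : ℂ := Complex.I * Real.sqrt 2
/-- `√−D = i·√D` -/
def smD (D : ℕ) : ℂ := Complex.I * Real.sqrt D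
/-- `√(2D)` -/
def s2D (D : ℕ) : ℂ := (Real.sqrt (2 * D) : ℝ)
/-- `w = (√(2D) + √−2)/2` -/
def w (D : ℕ) : ℂ := (s2D D + sm2) / 2
/-- `𝒪 = ℤ[√−2]` -/
def OO : Subring ℂ := Subring.closure {sm2}
/-- `R_f = 𝒪 + f·w·𝒪 = ℤ[√−2, f·w]`, an order in `K`. -/
def Rf (D f : ℕ) : Subring ℂ := Subring.closure {sm2, (f : ℂ) * w D}
/-- `R⁺_f = ℤ[f·√(2D)]`, an order in `K⁺`. -/
def Rpf (D f : ℕ) : Subring ℂ := Subring.closure {(f : ℂ) * s2D D}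
/-- `S_f = ℤ[f·√−D]`, an order in `L`. -/
def Sf (D f : ℕ) : Subring ℂ := Subring.closure {(f : ℂ) * smD D}
/-- `K = ℚ(√−2, √−D)` -/
def Kf (D : ℕ) : IntermediateField ℚ ℂ := IntermediateField.adjoin ℚ {sm2, smD D}
/-- `K⁺ = ℚ(√(2D))`, the maximal real subfield of `K`. -/
def Kp (D : ℕ) : IntermediateField ℚ ℂ := IntermediateField.adjoin ℚ {s2D D}
/-- `L = ℚ(√−D)` -/
def Lf (D : ℕ) : IntermediateField ℚ ℂ := IntermediateField.adjoin ℚ {smD D}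

section Lattice

open Module Submodule

variable {K : Type*} [Field K] [Algebra ℚ K]

/-- A nonzero finitely generated group stable under multiplication by a lattice is a lattice. -/
lemma isLattice_of_stable (R M : Submodule ℤ K) [IsLattice ℚ R]
    (hM : M.FG) (h0 : M ≠ ⊥) (hRM : ∀ r ∈ R, ∀ m ∈ M, r * m ∈ M) : IsLattice ℚ M := by
  refine ⟨hM, eq_top_iff.mpr fun x _ => ?_⟩
  obtain ⟨m, hm, hm0⟩ := M.ne_bot_iff.mp h0
  have hx : x * m⁻¹ ∈ span ℚ (R : Set K) := by
    rw [IsLattice.span_eq_top]; trivial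
  have key : ∀ y ∈ span ℚ (R : Set K), y * m ∈ span ℚ (M : Set K) := by
    intro y hy
    induction hy using span_induction with
    | mem r hr => exact subset_span (hRM r hr m hm)
    | zero => simp
    | add a b _ _ ha hb => rw [add_mul]; exact add_mem ha hb
    | smul c a _ ha => rw [smul_mul_assoc]; exact smul_mem _ c ha
  simpa [hm0] using key _ hx

variable (φ : K →ₗ[ℚ] ℚ)

/-- The symmetric bilinear form `(x, y) ↦ φ (x * y)` attached to a linear functional `φ`. -/
def mulForm : LinearMap.BilinForm ℚ K := (LinearMap.mul ℚ K).compr₂ φ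

@[simp] lemma mulForm_apply (x y : K) : mulForm φ x y = φ (x * y) := rfl

lemma mulForm_isSymm : (mulForm φ).IsSymm := ⟨fun x y => by simp [mul_comm]⟩

lemma mulForm_nondegenerate (hφ : φ ≠ 0) : (mulForm φ).Nondegenerate := by
  refine (mulForm_isSymm φ).isRefl.nondegenerate_iff_separatingLeft.mpr ?_
  intro x hx
  by_contra h0
  refine hφ (LinearMap.ext fun y => ?_)
  simpa [h0] using hx (x⁻¹ * y)

/-- The dual of a lattice is a lattice, and the lattice is its own double dual. -/
lemma isLattice_dual_and_dual_dual (hφ : φ ≠ 0) (M : Submodule ℤ K) [IsLattice ℚ M] :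
    IsLattice ℚ ((mulForm φ).dualSubmodule M) ∧
      (mulForm φ).dualSubmodule ((mulForm φ).dualSubmodule M) = M := by
  classical
  have hB := mulForm_nondegenerate φ hφ
  let b₀ := Free.chooseBasis ℤ M
  let b := b₀.extendOfIsLattice ℚ
  have hM : M = span ℤ (Set.range b) := by
    have h1 : Set.range b = M.subtype '' Set.range b₀ := by
      rw [← Set.range_comp]; congr 1; ext k; simp [b]
    rw [h1, ← map_span, b₀.span_eq, Submodule.map_top, range_subtype]
  refine ⟨⟨?_, ?_⟩, ?_⟩
  · rw [hM, LinearMap.BilinForm.dualSubmodule_span_of_basis _ hB]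
    exact fg_span (Set.finite_range _)
  · rw [hM, LinearMap.BilinForm.dualSubmodule_span_of_basis _ hB, span_span_of_tower,
      Basis.span_eq]
  · conv_lhs => rw [hM]
    rw [LinearMap.BilinForm.dualSubmodule_dualSubmodule_of_basis _ hB (mulForm_isSymm φ), ← hM]

/-- If the order `R` is self-dual for the form `(x, y) ↦ φ (x * y)`, then every lattice with
multiplier ring `R` is inverted by its dual. -/
lemma mul_dual_eq (hφ : φ ≠ 0) (R A : Submodule ℤ K) [IsLattice ℚ R] [IsLattice ℚ A]
    (hR : (mulForm φ).dualSubmodule R = R) (hRA : ∀ r ∈ R, ∀ a ∈ A, r * a ∈ A)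
    (hm : ∀ x, (∀ a ∈ A, x * a ∈ A) → x ∈ R) :
    A * (mulForm φ).dualSubmodule A = R := by
  obtain ⟨hlat, hdd⟩ := isLattice_dual_and_dual_dual φ hφ A
  have hne : ∀ M : Submodule ℤ K, IsLattice ℚ M → M ≠ ⊥ := by
    rintro M hM rfl
    have := hM.span_eq_top
    simp at this
  obtain ⟨a, ha, ha0⟩ := A.ne_bot_iff.mp (hne A inferInstance)
  obtain ⟨d, hd, hd0⟩ := (Submodule.ne_bot_iff _).mp (hne _ hlat)
  have hP : IsLattice ℚ (A * (mulForm φ).dualSubmodule A) := by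
    refine isLattice_of_stable R _ ?_ ?_ ?_
    · exact FG.mul IsLattice.fg hlat.fg
    · exact (Submodule.ne_bot_iff _).mpr ⟨a * d, mul_mem_mul ha hd, mul_ne_zero ha0 hd0⟩
    · intro r hr m hm
      induction hm using Submodule.mul_induction_on' with
      | mem_mul_mem a ha d hd => rw [← mul_assoc]; exact mul_mem_mul (hRA r hr a ha) hd
      | add x _ y _ hx hy => rw [mul_add]; exact add_mem hx hy
  refine le_antisymm (mul_le.mpr fun a ha d hd => ?_) ?_
  · rw [← hR]
    intro r hr
    have := hd (r * a) (hRA r hr a ha)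
    simp only [mulForm_apply] at this ⊢
    convert this using 2
    ring
  · have hle : (mulForm φ).dualSubmodule (A * (mulForm φ).dualSubmodule A) ≤ R := by
      intro x hx
      refine hm x fun a ha => ?_
      rw [← hdd]
      intro d hd
      have := hx _ (mul_mem_mul ha hd)
      simpa [mul_assoc] using this
    rw [← (isLattice_dual_and_dual_dual φ hφ (A * (mulForm φ).dualSubmodule A)).2]
    conv_lhs => rw [← hR]
    exact fun x hx y hy => hx y (hle hy)

/-- The order `ℤ[s, θ]` with `s² = -2` and `θ² = f s θ + m` is self-dual for the functional that
reads off the coefficient of `s θ`. -/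
lemma dual_span_basis_eq (e : Basis (Fin 4) ℚ K) (s θ : K) (f m : ℤ)
    (he : ⇑e = ![1, s, θ, s * θ]) (hs : s ^ 2 = -2) (hθ : θ ^ 2 = f * s * θ + m) :
    (mulForm (e.coord 3)).dualSubmodule (span ℤ (Set.range e)) = span ℤ (Set.range e) := by
  have e0 : e 0 = 1 := by simp [he]
  have e1 : e 1 = s := by simp [he]
  have e2 : e 2 = θ := by simp [he]
  have e3 : e 3 = s * θ := by simp [he]
  have hφ : ∀ p q r t : ℚ, e.coord 3 (p • 1 + q • s + r • θ + t • (s * θ)) = t := by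
    intro p q r t
    rw [← e0, ← e3, ← e1, ← e2]
    simp
  have hdual : ∀ x, x ∈ (mulForm (e.coord 3)).dualSubmodule (span ℤ (Set.range e)) ↔
      ∀ i, ∃ n : ℤ, (n : ℚ) = e.coord 3 (x * e i) := by
    intro x
    constructor
    · intro hx i
      simpa [Submodule.mem_one] using hx (e i) (subset_span ⟨i, rfl⟩)
    · intro hx y hy
      induction hy using span_induction with
      | mem y hy =>
        obtain ⟨i, rfl⟩ := hy
        simpa [Submodule.mem_one] using hx i
      | zero => simp
      | add a b _ _ ha hb => rw [map_add]; exact add_mem ha hb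
      | smul c a _ ha => rw [map_zsmul]; exact Submodule.smul_mem _ c ha
  have hspan : ∀ x, x ∈ span ℤ (Set.range e) ↔ ∀ i, ∃ n : ℤ, (n : ℚ) = e.repr x i := by
    intro x
    rw [e.mem_span_iff_repr_mem ℤ]
    simp
  ext x
  rw [hdual, hspan]
  have hx := e.sum_repr x
  simp only [Fin.sum_univ_four, e0, e1, e2, e3] at hx
  obtain ⟨p, hp⟩ : ∃ p, e.repr x 0 = p := ⟨_, rfl⟩
  obtain ⟨q, hq⟩ : ∃ q, e.repr x 1 = q := ⟨_, rfl⟩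
  obtain ⟨r, hr⟩ : ∃ r, e.repr x 2 = r := ⟨_, rfl⟩
  obtain ⟨t, ht⟩ : ∃ t, e.repr x 3 = t := ⟨_, rfl⟩
  rw [hp, hq, hr, ht] at hx
  have c0 : e.coord 3 (x * e 0) = t := by rw [e0, mul_one, ← hx, hφ]
  have c1 : e.coord 3 (x * e 1) = r := by
    rw [← hφ (-2 * q) p (-2 * t) r, ← hx, e1]
    congr 1
    simp only [Algebra.smul_def, map_mul, map_neg, map_ofNat]
    linear_combination (algebraMap ℚ K q + algebraMap ℚ K t * θ) * hs
  have c2 : e.coord 3 (x * e 2) = q + f * r := by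
    rw [← hφ (m * r) (m * t) (p - 2 * f * t) (q + f * r), ← hx, e2]
    congr 1
    simp only [Algebra.smul_def, map_mul, map_add, map_sub, map_ofNat, map_intCast]
    linear_combination (algebraMap ℚ K r + algebraMap ℚ K t * s) * hθ +
      (algebraMap ℚ K t * f * θ) * hs
  have c3 : e.coord 3 (x * e 3) = p - 2 * f * t := by
    rw [← hφ (-2 * m * t) (m * r) (-2 * q - 2 * f * r) (p - 2 * f * t), ← hx, e3]
    congr 1
    simp only [Algebra.smul_def, map_mul, map_sub, map_neg, map_ofNat, map_intCast]
    linear_combination (algebraMap ℚ K r * s + algebraMap ℚ K t * s ^ 2) * hθ +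
      (algebraMap ℚ K q * θ + algebraMap ℚ K r * f * θ +
        algebraMap ℚ K t * (f * s * θ + m)) * hs
  constructor
  · intro h
    obtain ⟨n0, h0⟩ := h 0
    obtain ⟨n1, h1⟩ := h 1
    obtain ⟨n2, h2⟩ := h 2
    obtain ⟨n3, h3⟩ := h 3
    rw [c0] at h0
    rw [c1] at h1
    rw [c2] at h2
    rw [c3] at h3
    rw [Fin.forall_fin_succ, Fin.forall_fin_succ, Fin.forall_fin_two]
    refine ⟨⟨n3 + 2 * f * n0, ?_⟩, ⟨n2 - f * n1, ?_⟩, ⟨n1, ?_⟩, ⟨n0, ?_⟩⟩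
    · refine Eq.trans ?_ hp.symm
      push_cast
      linear_combination h3 + 2 * f * h0
    · refine Eq.trans ?_ hq.symm
      push_cast
      linear_combination h2 - f * h1
    · exact h1.trans hr.symm
    · exact h0.trans ht.symm
  · intro h
    obtain ⟨n0, h0⟩ := h 0
    obtain ⟨n1, h1⟩ := h 1
    obtain ⟨n2, h2⟩ := h 2
    obtain ⟨n3, h3⟩ := h 3
    rw [hp] at h0
    rw [hq] at h1
    rw [hr] at h2
    rw [ht] at h3
    rw [Fin.forall_fin_succ, Fin.forall_fin_succ, Fin.forall_fin_two]
    refine ⟨⟨n3, ?_⟩, ⟨n2, ?_⟩, ⟨n1 + f * n2, ?_⟩, ⟨n0 - 2 * f * n3, ?_⟩⟩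
    · exact h3.trans c0.symm
    · exact h2.trans c1.symm
    · refine Eq.trans ?_ c2.symm
      push_cast
      linear_combination h1 + f * h2
    · refine Eq.trans ?_ c3.symm
      push_cast
      linear_combination h0 - 2 * f * h3

end Lattice

lemma sm2_sq : sm2 ^ 2 = -2 := by
  have h : ((Real.sqrt 2 : ℝ) : ℂ) ^ 2 = 2 := by
    exact_mod_cast Real.sq_sqrt (show (0 : ℝ) ≤ 2 by norm_num)
  rw [sm2, mul_pow, I_sq, h]
  ring

lemma sm2_ne_zero : sm2 ≠ 0 := fun h => by simpa [h] using sm2_sq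

lemma s2D_sq (D : ℕ) : s2D D ^ 2 = 2 * D := by
  have h : Real.sqrt (2 * D) ^ 2 = 2 * D := Real.sq_sqrt (by positivity)
  rw [s2D]
  exact_mod_cast h

lemma sm2_mul_s2D (D : ℕ) : sm2 * s2D D = 2 * smD D := by
  have h : Real.sqrt 2 * Real.sqrt (2 * D) = 2 * Real.sqrt D := by
    rw [Real.sqrt_mul (by norm_num), ← mul_assoc, Real.mul_self_sqrt (by norm_num)]
  have h' : ((Real.sqrt 2 : ℝ) : ℂ) * (Real.sqrt (2 * D) : ℝ) = 2 * (Real.sqrt D : ℝ) := by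
    exact_mod_cast h
  rw [sm2, s2D, smD]
  linear_combination I * h'

lemma sm2_mul_w (D : ℕ) : sm2 * w D = smD D - 1 := by
  rw [w]
  linear_combination sm2_mul_s2D D / 2 + sm2_sq / 2

lemma sq_mul_w (D f : ℕ) (hD4 : D % 4 = 1) :
    ((f : ℂ) * w D) ^ 2 =
      ((f : ℤ) : ℂ) * sm2 * ((f : ℂ) * w D) + (((f ^ 2 * ((D + 1) / 2) : ℕ) : ℤ) : ℂ) := by
  obtain ⟨k, hk⟩ : ∃ k, D = 2 * k + 1 := ⟨D / 2, by omega⟩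
  have h2 : (D + 1) / 2 = k + 1 := by omega
  have hDk : (D : ℂ) = 2 * k + 1 := by rw [hk]; push_cast; ring
  rw [h2, w]
  push_cast
  linear_combination (f : ℂ) ^ 2 / 4 * (s2D_sq D) - (f : ℂ) ^ 2 / 4 * sm2_sq +
    (f : ℂ) ^ 2 / 2 * hDk

lemma irrational_sqrt_two_mul (D : ℕ) (hD4 : D % 4 = 1) : Irrational (Real.sqrt (2 * D)) := by
  have : Irrational (Real.sqrt ((2 * D : ℕ) : ℝ)) := by
    rw [irrational_sqrt_natCast_iff]
    rintro ⟨n, hn⟩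
    have h4 : n * n % 4 = 2 := by omega
    have : n % 4 < 4 := Nat.mod_lt _ (by norm_num)
    rw [Nat.mul_mod] at h4
    interval_cases n % 4 <;> omega
  simpa using this

lemma eq_zero_of_rat_comb_sqrt {a x y : ℝ} (ha : Irrational a) (hx : x ∈ Set.range ((↑) : ℚ → ℝ))
    (hy : y ∈ Set.range ((↑) : ℚ → ℝ)) (h : x + y * a = 0) : x = 0 ∧ y = 0 := by
  obtain ⟨p, rfl⟩ := hx
  obtain ⟨q, rfl⟩ := hy
  have hq : (q : ℝ) = 0 := by
    by_contra hq
    refine ha ⟨-p / q, ?_⟩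
    push_cast
    field_simp
    linarith
  simp_all

/-- `1, √−2, f w, √−2 f w` satisfy no rational linear relation. -/
lemma coeff_eq_zero (D f : ℕ) (hD4 : D % 4 = 1) (hf : 0 < f) (p q r t : ℚ)
    (h : (p : ℂ) + q * sm2 + r * (f * w D) + t * (sm2 * (f * w D)) = 0) :
    p = 0 ∧ q = 0 ∧ r = 0 ∧ t = 0 := by
  have hirr := irrational_sqrt_two_mul D hD4
  have hw : sm2 * (f * w D) = f * (smD D - 1) := by rw [← sm2_mul_w]; ring
  rw [hw] at h
  have hf0 : (f : ℚ) ≠ 0 := by exact_mod_cast hf.ne'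
  have h2 : Real.sqrt 2 * Real.sqrt 2 = 2 := Real.mul_self_sqrt (by norm_num)
  have hD : Real.sqrt 2 * Real.sqrt D = Real.sqrt (2 * D) := by
    rw [Real.sqrt_mul (by norm_num)]
  have hre := congrArg Complex.re h
  have him := congrArg Complex.im h
  simp only [sm2, smD, w, s2D] at hre him
  simp only [add_re, mul_re, sub_re, div_ofNat_re, add_im, mul_im, sub_im, div_ofNat_im, ratCast_re,
    ratCast_im, natCast_re, natCast_im, ofReal_re, ofReal_im, I_re, I_im, one_re, one_im, zero_re,
    zero_im] at hre him
  obtain ⟨h1, h3⟩ := eq_zero_of_rat_comb_sqrt (x := p - t * f) (y := r * f / 2) hirr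
    ⟨p - t * f, by push_cast; ring⟩ ⟨r * f / 2, by push_cast; ring⟩ (by linear_combination hre)
  obtain ⟨h4, h5⟩ := eq_zero_of_rat_comb_sqrt (x := 2 * q + r * f) (y := t * f) hirr
    ⟨2 * q + r * f, by push_cast; ring⟩ ⟨t * f, by push_cast; ring⟩
    (by linear_combination Real.sqrt 2 * him - (q + r * f / 2) * h2 - t * f * hD)
  norm_cast at h1 h4 h5
  have h3' : r * f / 2 = 0 := by exact_mod_cast h3
  have ht : t = 0 := by simpa [hf0] using h5
  have hr : r = 0 := by simpa [hf0] using h3'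
  subst ht hr
  refine ⟨by simpa using h1, by simpa using h4, rfl, rfl⟩

/-- The set of `C`-linear combinations of `1, √−2, f w, √−2 f w`, for a subring `C` of `ℂ`,
is a subring. -/
def combSubring (D f : ℕ) (hD4 : D % 4 = 1) (C : Subring ℂ) : Subring ℂ where
  carrier := {x | ∃ p ∈ C, ∃ q ∈ C, ∃ r ∈ C, ∃ t ∈ C,
    x = p + q * sm2 + r * (f * w D) + t * (sm2 * (f * w D))}
  zero_mem' := ⟨0, zero_mem _, 0, zero_mem _, 0, zero_mem _, 0, zero_mem _, by ring⟩
  one_mem' := ⟨1, one_mem _, 0, zero_mem _, 0, zero_mem _, 0, zero_mem _, by ring⟩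
  add_mem' := by
    rintro _ _ ⟨p, hp, q, hq, r, hr, t, ht, rfl⟩ ⟨p', hp', q', hq', r', hr', t', ht', rfl⟩
    exact ⟨p + p', add_mem hp hp', q + q', add_mem hq hq', r + r', add_mem hr hr',
      t + t', add_mem ht ht', by ring⟩
  neg_mem' := by
    rintro _ ⟨p, hp, q, hq, r, hr, t, ht, rfl⟩
    exact ⟨-p, neg_mem hp, -q, neg_mem hq, -r, neg_mem hr, -t, neg_mem ht, by ring⟩
  mul_mem' := by
    rintro _ _ ⟨p, hp, q, hq, r, hr, t, ht, rfl⟩ ⟨p', hp', q', hq', r', hr', t', ht', rfl⟩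
    have hm : (((f ^ 2 * ((D + 1) / 2) : ℕ) : ℤ) : ℂ) ∈ C := intCast_mem C _
    have hf : ((f : ℤ) : ℂ) ∈ C := intCast_mem C _
    have h2 : (2 : ℂ) ∈ C := ofNat_mem C 2
    have hθ := sq_mul_w D f hD4
    generalize (((f ^ 2 * ((D + 1) / 2) : ℕ) : ℤ) : ℂ) = m at *
    generalize ((f : ℤ) : ℂ) = k at *
    generalize (f : ℂ) * w D = θ at *
    have hs := sm2_sq
    generalize sm2 = s at *
    refine ⟨p * p' - 2 * (q * q') + m * (r * r' - 2 * (t * t')), ?_,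
      p * q' + q * p' + m * (r * t' + t * r'), ?_,
      p * r' - 2 * (q * t') + (r * p' - 2 * (t * q')) - k * (2 * (r * t' + t * r')), ?_,
      p * t' + q * r' + (r * q' + t * p') + k * (r * r' - 2 * (t * t')), ?_, ?_⟩
    · exact add_mem (sub_mem (mul_mem hp hp') (mul_mem h2 (mul_mem hq hq')))
        (mul_mem hm (sub_mem (mul_mem hr hr') (mul_mem h2 (mul_mem ht ht'))))
    · exact add_mem (add_mem (mul_mem hp hq') (mul_mem hq hp'))
        (mul_mem hm (add_mem (mul_mem hr ht') (mul_mem ht hr')))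
    · exact sub_mem (add_mem (sub_mem (mul_mem hp hr') (mul_mem h2 (mul_mem hq ht')))
        (sub_mem (mul_mem hr hp') (mul_mem h2 (mul_mem ht hq'))))
        (mul_mem hf (mul_mem h2 (add_mem (mul_mem hr ht') (mul_mem ht hr'))))
    · exact add_mem (add_mem (add_mem (mul_mem hp ht') (mul_mem hq hr'))
        (add_mem (mul_mem hr hq') (mul_mem ht hp')))
        (mul_mem hf (sub_mem (mul_mem hr hr') (mul_mem h2 (mul_mem ht ht'))))
    · linear_combination (r + t * s) * (r' + t' * s) * hθ +
        (q * q' + (q * t' + t * q') * θ + t * t' * (k * s * θ + m) +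
          (r * t' + t * r') * k * θ) * hs

/-- `K` is spanned over `ℚ` by `1, √−2, f w, √−2 f w`. -/
lemma mem_Kf (D f : ℕ) (hD4 : D % 4 = 1) (hf : 0 < f) (x : ℂ) (hx : x ∈ Kf D) :
    ∃ p q r t : ℚ, x = (p : ℂ) + q * sm2 + r * (f * w D) + t * (sm2 * (f * w D)) := by
  have hf0 : (f : ℂ) ≠ 0 := by exact_mod_cast hf.ne'
  have halg : ∀ y ∈ ({sm2, smD D} : Set ℂ), IsAlgebraic ℚ y := by
    have h : ∀ (y : ℂ) (n : ℤ), y ^ 2 = n → IsAlgebraic ℚ y := by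
      intro y n hy
      refine IsAlgebraic.of_pow two_pos ?_
      rw [hy]
      exact isAlgebraic_intCast n
    rintro y (rfl | rfl)
    · exact h _ (-2) (by rw [sm2_sq]; norm_num)
    · refine h _ (-D) ?_
      have h1 : ((Real.sqrt D : ℝ) : ℂ) ^ 2 = D := by
        exact_mod_cast Real.sq_sqrt (Nat.cast_nonneg D)
      rw [smD, mul_pow, I_sq, h1]
      push_cast
      ring
  let C := (algebraMap ℚ ℂ).range
  have hx' : x ∈ combSubring D f hD4 C := by
    rw [Kf, ← IntermediateField.mem_toSubalgebra,
      IntermediateField.adjoin_toSubalgebra_of_isAlgebraic halg] at hx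
    induction hx using Algebra.adjoin_induction with
    | mem y hy =>
      rcases hy with rfl | rfl
      · exact ⟨0, zero_mem _, 1, one_mem _, 0, zero_mem _, 0, zero_mem _, by ring⟩
      · refine ⟨1, one_mem _, 0, zero_mem _, 0, zero_mem _, (f : ℂ)⁻¹, ⟨(f : ℚ)⁻¹, by simp⟩, ?_⟩
        have := sm2_mul_w D
        field_simp
        linear_combination -this
    | algebraMap r => exact ⟨_, ⟨r, rfl⟩, 0, zero_mem _, 0, zero_mem _, 0, zero_mem _, by ring⟩
    | add _ _ _ _ ha hb => exact add_mem ha hb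
    | mul _ _ _ _ ha hb => exact mul_mem ha hb
  obtain ⟨_, ⟨p, rfl⟩, _, ⟨q, rfl⟩, _, ⟨r, rfl⟩, _, ⟨t, rfl⟩, h⟩ := hx'
  exact ⟨p, q, r, t, by simpa using h⟩

lemma sm2_mem_Kf (D : ℕ) : sm2 ∈ Kf D := IntermediateField.subset_adjoin _ _ (by simp)

lemma mul_w_mem_Kf (D f : ℕ) : (f : ℂ) * w D ∈ Kf D := by
  have h : (f : ℂ) * w D = f * ((smD D - 1) / sm2) := by
    rw [← sm2_mul_w, mul_div_cancel_left₀ _ sm2_ne_zero]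
  rw [h]
  exact mul_mem (natCast_mem _ f) (div_mem (sub_mem (IntermediateField.subset_adjoin _ _ (by simp))
    (one_mem _)) (sm2_mem_Kf D))

lemma mem_Rf (D f : ℕ) (hD4 : D % 4 = 1) (x : ℂ) : x ∈ Rf D f ↔
    ∃ a b c d : ℤ, x = a + b * sm2 + c * (f * w D) + d * (sm2 * (f * w D)) := by
  constructor
  · intro hx
    have hle : Rf D f ≤ combSubring D f hD4 (algebraMap ℤ ℂ).range := by
      rw [Rf, Subring.closure_le]
      rintro y (rfl | rfl)
      · exact ⟨0, zero_mem _, 1, one_mem _, 0, zero_mem _, 0, zero_mem _, by ring⟩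
      · exact ⟨0, zero_mem _, 0, zero_mem _, 1, one_mem _, 0, zero_mem _, by ring⟩
    obtain ⟨_, ⟨p, rfl⟩, _, ⟨q, rfl⟩, _, ⟨r, rfl⟩, _, ⟨t, rfl⟩, h⟩ := hle hx
    exact ⟨p, q, r, t, by simpa using h⟩
  · rintro ⟨a, b, c, d, rfl⟩
    have hs : sm2 ∈ Rf D f := Subring.subset_closure (by simp)
    have hθ : (f : ℂ) * w D ∈ Rf D f := Subring.subset_closure (by simp)
    exact add_mem (add_mem (add_mem (intCast_mem _ a) (mul_mem (intCast_mem _ b) hs))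
      (mul_mem (intCast_mem _ c) hθ)) (mul_mem (intCast_mem _ d) (mul_mem hs hθ))

/-- The `ℚ`-basis `1, √−2, f w, √−2 f w` of `K`. -/
lemma exists_basis_Kf (D f : ℕ) (hD4 : D % 4 = 1) (hf : 0 < f) (s θ : Kf D)
    (hs : (s : ℂ) = sm2) (hθ : (θ : ℂ) = f * w D) :
    ∃ e : Module.Basis (Fin 4) ℚ (Kf D), ⇑e = ![1, s, θ, s * θ] := by
  have hli : LinearIndependent ℚ ![1, s, θ, s * θ] := by
    rw [Fintype.linearIndependent_iff]
    intro g hg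
    have h := congrArg (Subtype.val : Kf D → ℂ) hg
    simp [Fin.sum_univ_four, Algebra.smul_def, hs, hθ] at h
    obtain ⟨h0, h1, h2, h3⟩ := coeff_eq_zero D f hD4 hf _ _ _ _ h
    rw [Fin.forall_fin_succ, Fin.forall_fin_succ, Fin.forall_fin_two]
    exact ⟨h0, h1, h2, h3⟩
  refine ⟨Module.Basis.mk hli fun x _ => ?_, Module.Basis.coe_mk _ _⟩
  obtain ⟨p, q, r, t, h⟩ := mem_Kf D f hD4 hf x x.2
  rw [Submodule.mem_span_range_iff_exists_fun]
  refine ⟨![p, q, r, t], Subtype.ext ?_⟩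
  simp [Fin.sum_univ_four, Algebra.smul_def, hs, hθ, h]

lemma mem_span_basis_iff_mem_Rf (D f : ℕ) (hD4 : D % 4 = 1) (s θ : Kf D)
    (hs : (s : ℂ) = sm2) (hθ : (θ : ℂ) = f * w D) (x : Kf D) :
    x ∈ Submodule.span ℤ (Set.range ![1, s, θ, s * θ]) ↔ (x : ℂ) ∈ Rf D f := by
  rw [mem_Rf D f hD4, Submodule.mem_span_range_iff_exists_fun]
  constructor
  · rintro ⟨c, rfl⟩
    exact ⟨c 0, c 1, c 2, c 3, by simp [Fin.sum_univ_four, hs, hθ]⟩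
  · rintro ⟨a, b, c, d, h⟩
    refine ⟨![a, b, c, d], Subtype.ext ?_⟩
    simp [Fin.sum_univ_four, hs, hθ, h]

lemma Rf_finite (D f : ℕ) (hD4 : D % 4 = 1) : Module.Finite ℤ (Rf D f) := by
  have hs : sm2 ∈ Rf D f := Subring.subset_closure (by simp)
  have hθ : (f : ℂ) * w D ∈ Rf D f := Subring.subset_closure (by simp)
  let v : Fin 4 → Rf D f := ![1, ⟨_, hs⟩, ⟨_, hθ⟩, ⟨_, hs⟩ * ⟨_, hθ⟩]
  refine ⟨Submodule.fg_def.mpr ⟨Set.range v, Set.finite_range v, eq_top_iff.mpr fun x _ => ?_⟩⟩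
  obtain ⟨a, b, c, d, h⟩ := (mem_Rf D f hD4 x).mp x.2
  rw [Submodule.mem_span_range_iff_exists_fun]
  refine ⟨![a, b, c, d], Subtype.ext ?_⟩
  simp [Fin.sum_univ_four, v, h]

/-- Every nonzero finitely generated `R_f`-submodule `𝔄` of `K` whose multiplier ring
`{x ∈ K : x·𝔄 ⊆ 𝔄}` equals `R_f` is an invertible fractional `R_f`-ideal: there is a
nonzero finitely generated `R_f`-submodule `𝔅` of `K` with `𝔄·𝔅 = R_f`.
(This holds because `R_f` is a Gorenstein ring.) -/
theorem deligne_module_invertible (D : ℕ) (hD0 : 0 < D)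
    (hDsf : Squarefree D) (hD4 : D % 4 = 1) (f : ℕ) (hf1 : Odd f) (hf0 : 0 < f)
    (A : Submodule (Rf D f) ℂ) (hA0 : A ≠ ⊥) (hAfg : A.FG) (hAK : (A : Set ℂ) ⊆ Kf D)
    (hmult : {x : ℂ | x ∈ Kf D ∧ ∀ a ∈ (A : Set ℂ), x * a ∈ A} = (Rf D f : Set ℂ)) :
    ∃ B : Submodule (Rf D f) ℂ, B ≠ ⊥ ∧ B.FG ∧ (B : Set ℂ) ⊆ Kf D ∧ A * B = 1 := by
  obtain ⟨s, hs⟩ : ∃ s : Kf D, (s : ℂ) = sm2 := ⟨⟨_, sm2_mem_Kf D⟩, rfl⟩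
  obtain ⟨θ, hθ⟩ : ∃ θ : Kf D, (θ : ℂ) = f * w D := ⟨⟨_, mul_w_mem_Kf D f⟩, rfl⟩
  obtain ⟨e, he⟩ := exists_basis_Kf D f hD4 hf0 s θ hs hθ
  have := Rf_finite D f hD4
  let φ := e.coord 3
  have hφ : φ ≠ 0 := fun h => by simpa [φ] using LinearMap.congr_fun h (e 3)
  let ι : Kf D →ₗ[ℤ] ℂ := (Kf D).val.toLinearMap.restrictScalars ℤ
  have hι : Function.Injective ι := Subtype.val_injective
  let R' : Submodule ℤ (Kf D) := Submodule.span ℤ (Set.range e)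
  have hR' : ∀ x : Kf D, x ∈ R' ↔ (x : ℂ) ∈ Rf D f := by
    intro x
    rw [← mem_span_basis_iff_mem_Rf D f hD4 s θ hs hθ, ← he]
  have hRlat : Submodule.IsLattice ℚ R' :=
    ⟨Submodule.fg_span (Set.finite_range _), by
      rw [Submodule.span_span_of_tower, Module.Basis.span_eq]⟩
  have hRdual : (mulForm φ).dualSubmodule R' = R' := by
    refine dual_span_basis_eq e s θ f ((f ^ 2 * ((D + 1) / 2) : ℕ) : ℤ) he ?_ ?_
    · refine Subtype.ext ?_
      push_cast
      rw [hs, sm2_sq]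
      rfl
    · exact Subtype.ext (by simpa [hs, hθ] using sq_mul_w D f hD4)
  have hRK : ∀ r : Rf D f, (r : ℂ) ∈ Kf D := fun r => by
    have := r.2
    rw [← SetLike.mem_coe, ← hmult] at this
    exact this.1
  let A' : Submodule ℤ (Kf D) := (A.restrictScalars ℤ).comap ι
  have hA' : ∀ x : Kf D, x ∈ A' ↔ (x : ℂ) ∈ A := fun x => Iff.rfl
  have hRA : ∀ r ∈ R', ∀ a ∈ A', r * a ∈ A' := fun r hr a ha =>
    A.smul_mem (⟨r, (hR' r).mp hr⟩ : Rf D f) ha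
  have hA'map : A'.map ι = A.restrictScalars ℤ := by
    rw [Submodule.map_comap_eq, inf_eq_right]
    exact fun x hx => ⟨⟨x, hAK hx⟩, rfl⟩
  have hAlat : Submodule.IsLattice ℚ A' := by
    refine isLattice_of_stable R' A' ?_ ?_ hRA
    · refine Submodule.fg_of_fg_map_injective ι hι ?_
      rw [hA'map]
      exact Submodule.FG.restrictScalars hAfg
    · obtain ⟨a, ha, ha0⟩ := A.ne_bot_iff.mp hA0
      exact (Submodule.ne_bot_iff _).mpr ⟨⟨a, hAK ha⟩, ha, fun h => ha0 (congrArg Subtype.val h)⟩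
  have hmul := mul_dual_eq φ hφ R' A' hRdual hRA fun x hx => by
    rw [hR', ← SetLike.mem_coe, ← hmult]
    exact ⟨x.2, fun a ha => hx ⟨a, hAK ha⟩ ha⟩
  set B' := (mulForm φ).dualSubmodule A'
  have hBfg : B'.FG := (isLattice_dual_and_dual_dual φ hφ A').1.fg
  let B : Submodule (Rf D f) ℂ :=
    { (B'.map ι).toAddSubmonoid with
      smul_mem' := by
        rintro r _ ⟨b, hb, rfl⟩
        refine ⟨⟨r, hRK r⟩ * b, fun a ha => ?_, rfl⟩
        have := hb (⟨r, hRK r⟩ * a) (hRA _ ((hR' _).mpr r.2) a ha)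
        simp only [mulForm_apply] at this ⊢
        convert this using 2
        ring }
  have hBmem : ∀ b ∈ B', (b : ℂ) ∈ B := fun b hb => ⟨b, hb, rfl⟩
  have hone : (1 : ℂ) ∈ A * B := by
    have key : ∀ x ∈ A' * B', (x : ℂ) ∈ A * B := by
      intro x hx
      induction hx using Submodule.mul_induction_on' with
      | mem_mul_mem a ha b hb => exact Submodule.mul_mem_mul ha (hBmem b hb)
      | add x _ y _ hx hy => exact add_mem hx hy
    refine key 1 ?_
    rw [hmul, hR']
    exact one_mem _
  refine ⟨B, ?_, ?_, ?_, le_antisymm (Submodule.mul_le.mpr ?_) (Submodule.one_le.mpr hone)⟩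
  · intro h
    rw [h, Submodule.mul_bot] at hone
    exact one_ne_zero hone
  · exact Submodule.FG.of_restrictScalars (R := ℤ) (hBfg.map ι)
  · rintro _ ⟨b, _, rfl⟩
    exact b.2
  · rintro a ha _ ⟨b, hb, rfl⟩
    have h : (⟨a, hAK ha⟩ : Kf D) * b ∈ A' * B' := Submodule.mul_mem_mul ha hb
    rw [hmul, hR'] at h
    exact Submodule.mem_one.mpr ⟨⟨_, h⟩, rfl⟩
end
end

section
/- Let q be a power of an odd prime, write 2q−1 = F²·D with D squarefree and F a positive integer, and let π = (F·√(2D) + √−2)/2 ∈ K. If A is a subring of K that is finitely generated as a ℤ-module, contains π, and is stable under complex conjugation, then A = R_f for some positive divisor f of F. -/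
noncomputable section
open Complex Pointwise

theorem sm2_mul_self : sm2 * sm2 = -2 := by
  have h : ((Real.sqrt 2 : ℝ) : ℂ) * (Real.sqrt 2 : ℝ) = 2 := by
    rw [← Complex.ofReal_mul, Real.mul_self_sqrt (by norm_num)]; norm_num
  unfold sm2
  linear_combination (Complex.I * Complex.I) * h + 2 * Complex.I_mul_I

theorem s2D_mul_self (D : ℕ) : s2D D * s2D D = 2 * D := by
  unfold s2D
  rw [← Complex.ofReal_mul, Real.mul_self_sqrt (by positivity)]
  push_cast; rfl

theorem s2D_mul_sm2 (D : ℕ) : s2D D * sm2 = 2 * smD D := by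
  have h : ((Real.sqrt 2 : ℝ) : ℂ) * (Real.sqrt 2 : ℝ) = 2 := by
    rw [← Complex.ofReal_mul, Real.mul_self_sqrt (by norm_num)]; norm_num
  unfold s2D sm2 smD
  rw [Real.sqrt_mul (by norm_num)]
  push_cast
  linear_combination (Complex.I * ((Real.sqrt D : ℝ) : ℂ)) * h

theorem conj_sm2 : (starRingEnd ℂ) sm2 = -sm2 := by
  simp [sm2]

theorem conj_s2D (D : ℕ) : (starRingEnd ℂ) (s2D D) = s2D D := by
  simp only [s2D, Complex.conj_ofReal]

theorem conj_smD (D : ℕ) : (starRingEnd ℂ) (smD D) = -smD D := by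
  simp [smD]

theorem sm2_mul_smD (D : ℕ) : sm2 * smD D = -s2D D := by
  linear_combination (-1 / 2 : ℂ) * sm2 * s2D_mul_sm2 D + (s2D D / 2) * sm2_mul_self

theorem s2D_mul_smD (D : ℕ) : s2D D * smD D = D * sm2 := by
  linear_combination (-1 / 2 : ℂ) * s2D D * s2D_mul_sm2 D + (sm2 / 2) * s2D_mul_self D

theorem smD_mul_self (D : ℕ) : smD D * smD D = -D := by
  linear_combination (-1 / 2 : ℂ) * smD D * s2D_mul_sm2 D + (s2D D / 2) * sm2_mul_smD D
    - (1 / 2 : ℂ) * s2D_mul_self D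

/-- Every element of `K` is a rational combination of `1, √−2, √(2D), √−D`. -/
theorem exists_rat_coords_of_mem_Kf {D : ℕ} {x : ℂ} (hx : x ∈ Kf D) :
    ∃ a b c d : ℚ, x = a + b * sm2 + c * s2D D + d * smD D := by
  have halg : ∀ y ∈ ({sm2, smD D} : Set ℂ), IsAlgebraic ℚ y := by
    have key : ∀ (y : ℂ) (n : ℕ), y * y = -n → IsAlgebraic ℚ y := by
      intro y n h
      refine ⟨Polynomial.X ^ 2 + Polynomial.C (n : ℚ),
        Polynomial.X_pow_add_C_ne_zero (by norm_num) _, ?_⟩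
      simp [pow_two, h]
    rintro y (rfl | rfl)
    · exact key _ 2 (by simpa using sm2_mul_self)
    · exact key _ D (smD_mul_self D)
  have hx' : x ∈ Algebra.adjoin ℚ ({sm2, smD D} : Set ℂ) := by
    rw [← IntermediateField.adjoin_toSubalgebra_of_isAlgebraic halg]
    exact hx
  clear hx
  induction hx' using Algebra.adjoin_induction with
  | mem y hy =>
    rcases hy with rfl | rfl
    · exact ⟨0, 1, 0, 0, by simp⟩
    · exact ⟨0, 0, 0, 1, by simp⟩
  | algebraMap r => exact ⟨r, 0, 0, 0, by simp⟩
  | add y z _ _ hy hz =>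
    obtain ⟨a, b, c, d, rfl⟩ := hy
    obtain ⟨a', b', c', d', rfl⟩ := hz
    refine ⟨a + a', b + b', c + c', d + d', ?_⟩
    push_cast; ring
  | mul y z _ _ hy hz =>
    obtain ⟨a, b, c, d, rfl⟩ := hy
    obtain ⟨a', b', c', d', rfl⟩ := hz
    refine ⟨a * a' - 2 * b * b' + 2 * D * c * c' - D * d * d',
      a * b' + b * a' + D * c * d' + D * d * c',
      a * c' + c * a' - b * d' - d * b',
      a * d' + d * a' + 2 * b * c' + 2 * c * b', ?_⟩
    push_cast
    linear_combination (b * b' : ℂ) * sm2_mul_self + (c * c' : ℂ) * s2D_mul_self D +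
      (d * d' : ℂ) * smD_mul_self D + (b * c' + c * b' : ℂ) * s2D_mul_sm2 D +
      (b * d' + d * b' : ℂ) * sm2_mul_smD D + (c * d' + d * c' : ℂ) * s2D_mul_smD D

theorem exists_int_of_squarefree_mul_sq {N : ℕ} (hN : Squarefree N) {v : ℚ} {m : ℤ}
    (h : (N : ℚ) * v ^ 2 = m) : ∃ k : ℤ, v = k := by
  have hd : (v.den : ℚ) ≠ 0 := by exact_mod_cast v.den_ne_zero
  have h1 : (N : ℤ) * v.num ^ 2 = m * (v.den : ℤ) ^ 2 := by
    have : (N : ℚ) * v.num ^ 2 = m * (v.den : ℚ) ^ 2 := by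
      rw [← h]
      nth_rewrite 2 [← Rat.num_div_den v]
      field_simp
    exact_mod_cast this
  have hcop : IsCoprime ((v.den : ℤ) ^ 2) (v.num ^ 2) :=
    (Int.isCoprime_iff_gcd_eq_one.mpr (by
      have := v.reduced
      rw [Int.gcd_comm]
      simpa [Int.gcd, Nat.Coprime] using this)).pow
  have h2 : (v.den : ℤ) ^ 2 ∣ N :=
    hcop.dvd_of_dvd_mul_right (Dvd.intro_left m h1.symm)
  have h3 : v.den * v.den ∣ N := by
    rw [← pow_two]; exact_mod_cast h2
  have h4 : v.den = 1 := Nat.isUnit_iff.mp (hN _ h3)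
  exact ⟨v.num, ((Rat.den_eq_one_iff v).mp h4).symm⟩

theorem squarefree_two_mul {D : ℕ} (hD : Squarefree D) (hodd : Odd D) :
    Squarefree (2 * D) :=
  Nat.squarefree_mul_iff.mpr ⟨Nat.coprime_two_left.mpr hodd, Nat.prime_two.squarefree, hD⟩

theorem s2D_ne_ratCast {D : ℕ} (hD : Squarefree D) (hodd : Odd D) (r : ℚ) :
    s2D D ≠ r := by
  intro h
  have h1 : r ^ 2 = 2 * D := by
    have := s2D_mul_self D
    rw [h] at this
    rw [pow_two]; exact_mod_cast this
  have h2 : ((1 : ℕ) : ℚ) * r ^ 2 = ((2 * D : ℤ) : ℚ) := by rw [h1]; push_cast; ring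
  obtain ⟨k, rfl⟩ := exists_int_of_squarefree_mul_sq squarefree_one h2
  have h3 : k.natAbs * k.natAbs = 2 * D := by
    have : k * k = 2 * D := by rw [← pow_two]; exact_mod_cast h1
    zify; rw [abs_mul_abs_self]; exact this
  have h4 := Nat.isUnit_iff.mp (squarefree_two_mul hD hodd _ (Dvd.intro 1 (by rw [← h3, mul_one])))
  rw [h4] at h3
  omega

/-- The ring of integers of `ℚ(√(2D))` is `ℤ[√(2D)]`. -/
theorem exists_int_coords_of_isIntegral {D : ℕ} (hD : Squarefree D) (hodd : Odd D) {u v : ℚ}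
    (h : IsIntegral ℤ ((u : ℂ) + v * s2D D)) : ∃ m n : ℤ, u = m ∧ v = n := by
  by_cases hv : v = 0
  · subst hv
    have h1 : IsIntegral ℤ (algebraMap ℚ ℂ u) := by simpa using h
    rw [isIntegral_algebraMap_iff (algebraMap ℚ ℂ).injective] at h1
    obtain ⟨m, hm⟩ := IsIntegrallyClosed.isIntegral_iff.mp h1
    exact ⟨m, 0, by simpa using hm.symm, by simp⟩
  set y : ℂ := (u : ℂ) + v * s2D D with hy
  set P : Polynomial ℚ := Polynomial.X ^ 2 + (Polynomial.C (-(2 * u)) * Polynomial.X +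
    Polynomial.C (u ^ 2 - 2 * D * v ^ 2)) with hP
  have hPm : P.Monic := Polynomial.monic_X_pow_add Polynomial.degree_linear_lt
  have hPdeg : P.natDegree = 2 := by
    rw [hP]; compute_degree!
  have hroot : Polynomial.aeval y P = 0 := by
    simp [hP, hy]
    linear_combination (v : ℂ) ^ 2 * s2D_mul_self D
  have hyQ : IsIntegral ℚ y := h.tower_top
  have hnot : y ∉ (algebraMap ℚ ℂ).range := by
    rintro ⟨r, hr⟩
    refine s2D_ne_ratCast hD hodd ((r - u) / v) ?_
    have hv' : (v : ℂ) ≠ 0 := by exact_mod_cast hv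
    have hr' : (r : ℂ) = u + v * s2D D := by simpa [hy] using hr
    push_cast
    field_simp
    linear_combination -hr'
  have hmin : minpoly ℚ y = P := by
    refine (Polynomial.eq_of_monic_of_dvd_of_natDegree_le (minpoly.monic hyQ) hPm
      (minpoly.dvd ℚ y hroot) ?_).symm
    rw [hPdeg]
    exact (minpoly.two_le_natDegree_iff hyQ).mpr hnot
  have hmap : P = (minpoly ℤ y).map (algebraMap ℤ ℚ) := by
    rw [← hmin]; exact minpoly.isIntegrallyClosed_eq_field_fractions' ℚ h
  have hc : ∀ i, P.coeff i = ((minpoly ℤ y).coeff i : ℤ) := by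
    intro i; rw [hmap, Polynomial.coeff_map]; simp
  have hc1 : -(2 * u) = ((minpoly ℤ y).coeff 1 : ℤ) := by
    rw [← hc 1, hP]
    simp only [Polynomial.coeff_add, Polynomial.coeff_X_pow, Polynomial.coeff_C_mul,
      Polynomial.coeff_X, Polynomial.coeff_C]
    norm_num
  have hc0 : u ^ 2 - 2 * D * v ^ 2 = ((minpoly ℤ y).coeff 0 : ℤ) := by
    rw [← hc 0, hP]
    simp only [Polynomial.coeff_add, Polynomial.coeff_X_pow, Polynomial.coeff_C_mul,
      Polynomial.coeff_X, Polynomial.coeff_C]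
    norm_num
  generalize (minpoly ℤ y).coeff 1 = s at hc1
  generalize (minpoly ℤ y).coeff 0 = n at hc0
  obtain ⟨V, hV⟩ : ∃ V : ℤ, 2 * v = V := by
    refine exists_int_of_squarefree_mul_sq (squarefree_two_mul hD hodd)
      (m := s ^ 2 - 4 * n) ?_
    push_cast
    rw [← hc1, ← hc0]; ring
  have hn : s ^ 2 - 2 * D * V ^ 2 = 4 * n := by
    have : (s : ℚ) ^ 2 - 2 * D * V ^ 2 = 4 * n := by
      rw [← hc1, ← hc0, ← hV]; ring
    exact_mod_cast this
  obtain ⟨s', rfl⟩ : Even s := by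
    have : Even (s ^ 2) := ⟨D * V ^ 2 + 2 * n, by linarith⟩
    exact (Int.even_pow.mp this).1
  obtain ⟨V', rfl⟩ : Even V := by
    have h1 : Even ((D : ℤ) * V ^ 2) := ⟨s' ^ 2 - n, by linarith⟩
    rcases Int.even_mul.mp h1 with h2 | h2
    · exact absurd ((Int.even_coe_nat D).mp h2) (Nat.not_even_iff_odd.mpr hodd)
    · exact (Int.even_pow.mp h2).1
  refine ⟨-s', V', ?_, ?_⟩
  · push_cast at hc1 ⊢; linarith
  · push_cast at hV; linarith

theorem integral_coords_parity {D a b c d N M : ℤ} (hD : D % 4 = 1)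
    (hN : 2 * a ^ 2 + 4 * D * c ^ 2 + b ^ 2 + 2 * D * d ^ 2 = 8 * N)
    (hM : 2 * (a * c) + b * d = 4 * M) :
    ∃ a' c' d' k : ℤ, a = 2 * a' ∧ d = 2 * d' ∧ c = c' ∧ b = 2 * (c' + 2 * k) := by
  obtain ⟨e, rfl⟩ : ∃ e, D = 4 * e + 1 := ⟨D / 4, by omega⟩
  obtain ⟨b, rfl⟩ : Even b := by
    have : Even (b ^ 2) := ⟨4 * N - a ^ 2 - 2 * (4 * e + 1) * c ^ 2 - (4 * e + 1) * d ^ 2, by linarith⟩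
    exact (Int.even_pow.mp this).1
  have hM' : a * c + b * d = 2 * M := by linarith
  have hN' : a ^ 2 + 2 * (4 * e + 1) * c ^ 2 + 2 * b ^ 2 + (4 * e + 1) * d ^ 2 = 4 * N := by
    linarith
  have hpar : a % 2 = 0 ∧ d % 2 = 0 ∧ (b - c) % 2 = 0 := by
    rcases Int.even_or_odd' a with ⟨a, rfl | rfl⟩ <;> rcases Int.even_or_odd' d with ⟨d, rfl | rfl⟩ <;>
    rcases Int.even_or_odd' b with ⟨b, rfl | rfl⟩ <;> rcases Int.even_or_odd' c with ⟨c, rfl | rfl⟩ <;>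
    ring_nf at hM' hN' <;> omega
  exact ⟨a / 2, c, d / 2, (b - c) / 2, by omega, by omega, rfl, by omega⟩

theorem isIntegral_of_mem_of_fg {A : Subring ℂ} (hfg : A.toAddSubgroup.FG) {x : ℂ} (hx : x ∈ A) :
    IsIntegral ℤ x := by
  have hfg' : (Subalgebra.toSubmodule (subalgebraOfSubring A)).FG := by
    rw [Submodule.fg_iff_addSubgroup_fg]
    exact hfg
  exact IsIntegral.of_mem_of_fg (subalgebraOfSubring A) hfg' x hx

/-- Elements of a conjugation-stable order of `K` containing `√−2` lie in `𝒪 + w𝒪`. -/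
theorem exists_int_coords_of_mem {D : ℕ} (hD : Squarefree D) (hD4 : D % 4 = 1) {A : Subring ℂ}
    (hAK : (A : Set ℂ) ⊆ Kf D) (hfg : A.toAddSubgroup.FG) (hr : sm2 ∈ A)
    (hconj : ∀ x ∈ A, (starRingEnd ℂ) x ∈ A) {x : ℂ} (hx : x ∈ A) :
    ∃ m n k l : ℤ, x = (m + n * sm2) + (k + l * sm2) * w D := by
  have hodd : Odd D := Nat.odd_iff.mpr (by omega)
  obtain ⟨a, b, c, d, rfl⟩ := exists_rat_coords_of_mem_Kf (hAK hx)
  set x : ℂ := a + b * sm2 + c * s2D D + d * smD D with hxdef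
  have hcx : (starRingEnd ℂ) x = a - b * sm2 + c * s2D D - d * smD D := by
    simp only [hxdef, map_add, map_mul, conj_sm2, conj_s2D, conj_smD, map_ratCast]
    ring
  have hcoord : ∀ {u v : ℚ}, (u : ℂ) + v * s2D D ∈ A → ∃ m n : ℤ, u = m ∧ v = n := fun h =>
    exists_int_coords_of_isIntegral hD hodd (isIntegral_of_mem_of_fg hfg h)
  obtain ⟨a', c', ha, hc⟩ := hcoord (u := 2 * a) (v := 2 * c) (by
    convert A.add_mem hx (hconj x hx) using 1
    rw [hcx, hxdef]; push_cast; ring)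
  obtain ⟨b', d', hb, hd⟩ := hcoord (u := -4 * b) (v := -2 * d) (by
    convert A.mul_mem hr (A.sub_mem hx (hconj x hx)) using 1
    rw [hcx, hxdef]; push_cast
    linear_combination (-2 * b : ℂ) * sm2_mul_self - (2 * d : ℂ) * sm2_mul_smD D)
  obtain ⟨N, M, hN, hM⟩ := hcoord (u := a ^ 2 + 2 * D * c ^ 2 + 2 * b ^ 2 + D * d ^ 2)
    (v := 2 * a * c + 2 * b * d) (by
    convert A.mul_mem hx (hconj x hx) using 1
    rw [hcx, hxdef]; push_cast
    linear_combination (b ^ 2 : ℂ) * sm2_mul_self - (c ^ 2 : ℂ) * s2D_mul_self D +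
      (d ^ 2 : ℂ) * smD_mul_self D + (2 * b * d : ℂ) * sm2_mul_smD D)
  have ha1 : a = a' / 2 := by linarith
  have hb1 : b = -b' / 4 := by linarith
  have hc1 : c = c' / 2 := by linarith
  have hd1 : d = -d' / 2 := by linarith
  obtain ⟨a₁, c₁, d₁, k, h1, h2, h3, h4⟩ := integral_coords_parity (D := D) (a := a') (b := -b')
    (c := c') (d := -d') (N := N) (M := M) (by omega)
    (by
      rw [ha1, hb1, hc1, hd1] at hN
      have : (2 * a' ^ 2 + 4 * D * c' ^ 2 + (-b') ^ 2 + 2 * D * (-d') ^ 2 : ℚ) = 8 * N := by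
        rw [← hN]; ring
      exact_mod_cast this)
    (by
      rw [ha1, hb1, hc1, hd1] at hM
      have : (2 * (a' * c') + (-b') * (-d') : ℚ) = 4 * M := by rw [← hM]; ring
      exact_mod_cast this)
  have ha2 : a = a₁ := by rw [ha1, h1]; push_cast; ring
  have hb2 : b = (c₁ + 2 * k) / 2 := by
    have : (-b' : ℚ) = 2 * (c₁ + 2 * k) := by exact_mod_cast h4
    rw [hb1, this]; ring
  have hc2 : c = c₁ / 2 := by rw [hc1, h3]
  have hd2 : d = d₁ := by
    have : (-d' : ℚ) = 2 * d₁ := by exact_mod_cast h2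
    rw [hd1, this]; ring
  refine ⟨a₁ + d₁, k, c₁, d₁, ?_⟩
  rw [hxdef, ha2, hb2, hc2, hd2]
  unfold w
  push_cast
  linear_combination (-d₁ / 2 : ℂ) * s2D_mul_sm2 D - (d₁ / 2 : ℂ) * sm2_mul_self

theorem intCast_mul_w_mem {D F : ℕ} {A : Subring ℂ} (hF : Odd F) (hr : sm2 ∈ A)
    (hconj : ∀ x ∈ A, (starRingEnd ℂ) x ∈ A) (hFw : (F : ℂ) * w D ∈ A) {k l : ℤ}
    (h : (k + l * sm2) * w D ∈ A) : (k : ℂ) * w D ∈ A ∧ (l : ℂ) * w D ∈ A := by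
  have half : ∀ m : ℤ, 2 * ((m : ℂ) * w D) ∈ A → (m : ℂ) * w D ∈ A := by
    intro m hm
    obtain ⟨j, rfl⟩ := hF
    convert A.sub_mem (A.mul_mem (intCast_mem A m) hFw) (A.mul_mem (natCast_mem A j) hm) using 1
    push_cast; ring
  have hcw : (starRingEnd ℂ) (w D) = w D - sm2 := by
    simp only [w, map_div₀, map_add, conj_s2D, conj_sm2, map_ofNat]
    ring
  have hk : (k : ℂ) * w D ∈ A := by
    apply half
    have h1 := hconj _ h
    simp only [map_mul, map_add, map_intCast, conj_sm2, hcw] at h1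
    have h2 : sm2 * (k - l * sm2) ∈ A :=
      A.mul_mem hr (A.sub_mem (intCast_mem A k) (A.mul_mem (intCast_mem A l) hr))
    convert A.add_mem (A.add_mem h h1) h2 using 1
    ring
  refine ⟨hk, half l ?_⟩
  convert A.neg_mem (A.mul_mem hr (A.sub_mem h hk)) using 1
  linear_combination (l : ℂ) * w D * sm2_mul_self

theorem mod_four_eq_one {q F D : ℕ} (hq : Odd q) (h : 2 * q = F ^ 2 * D + 1) :
    Odd F ∧ D % 4 = 1 := by
  obtain ⟨t, rfl⟩ := hq
  have hF : Odd F := by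
    by_contra hF
    obtain ⟨j, rfl⟩ := Nat.not_odd_iff_even.mp hF
    have : (j + j) ^ 2 * D = 2 * (2 * (j ^ 2 * D)) := by ring
    omega
  refine ⟨hF, ?_⟩
  obtain ⟨j, rfl⟩ := hF
  have : (2 * j + 1) ^ 2 * D = 4 * ((j ^ 2 + j) * D) + D := by ring
  omega

/-- Let `q` be a power of an odd prime, `2q − 1 = F²·D` with `D` squarefree and
`F` positive, and `π = (F·√(2D) + √−2)/2 ∈ K`.  If `A` is a subring of `K` that is
finitely generated as a `ℤ`-module, contains `π`, and is stable under complex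
conjugation, then `A = R_f` for some positive divisor `f` of `F`. -/
theorem subring_eq_Rf (q p n F D : ℕ) (hp : p.Prime) (hodd : Odd p) (hn : 0 < n)
    (hq : q = p ^ n) (hF : 0 < F) (hDsf : Squarefree D) (hFD : 2 * q = F ^ 2 * D + 1)
    (A : Subring ℂ) (hAK : (A : Set ℂ) ⊆ Kf D) (hfg : A.toAddSubgroup.FG)
    (hπ : ((F : ℂ) * s2D D + sm2) / 2 ∈ A)
    (hconj : ∀ x ∈ A, (starRingEnd ℂ) x ∈ A) :
    ∃ f : ℕ, 0 < f ∧ f ∣ F ∧ A = Rf D f := by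
  obtain ⟨hFodd, hD4⟩ := mod_four_eq_one (hq ▸ hodd.pow) hFD
  have hr : sm2 ∈ A := by
    convert A.sub_mem hπ (hconj _ hπ) using 1
    simp only [map_div₀, map_add, map_mul, map_natCast, conj_s2D, conj_sm2, map_ofNat]
    ring
  have hFw : (F : ℂ) * w D ∈ A := by
    obtain ⟨j, rfl⟩ := hFodd
    convert A.add_mem hπ (A.mul_mem (natCast_mem A j) hr) using 1
    unfold w
    push_cast; ring
  let J : AddSubgroup ℤ := A.toAddSubgroup.comap
    ((AddMonoidHom.mulRight (w D)).comp (Int.castAddHom ℂ))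
  have hJ : ∀ k : ℤ, k ∈ J ↔ (k : ℂ) * w D ∈ A := fun _ => Iff.rfl
  obtain ⟨f, hdvd⟩ : ∃ f : ℕ, ∀ k : ℤ, (k : ℂ) * w D ∈ A ↔ (f : ℤ) ∣ k := by
    obtain ⟨g, hg⟩ := Int.subgroup_cyclic J
    refine ⟨g.natAbs, fun k => ?_⟩
    rw [← hJ, hg, ← AddSubgroup.zmultiples_eq_closure, Int.mem_zmultiples_iff, Int.natAbs_dvd]
  have hfF : f ∣ F := by
    exact_mod_cast (hdvd F).mp (by exact_mod_cast hFw)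
  refine ⟨f, Nat.pos_of_dvd_of_pos hfF hF, hfF, le_antisymm ?_ ?_⟩
  · intro x hx
    obtain ⟨m, n', k, l, rfl⟩ := exists_int_coords_of_mem hDsf hD4 hAK hfg hr hconj hx
    have hO : ((m : ℂ) + n' * sm2) ∈ A :=
      A.add_mem (intCast_mem A m) (A.mul_mem (intCast_mem A n') hr)
    obtain ⟨hk, hl⟩ := intCast_mul_w_mem hFodd hr hconj hFw (by simpa using A.sub_mem hx hO)
    obtain ⟨k', rfl⟩ := (hdvd k).mp hk
    obtain ⟨l', rfl⟩ := (hdvd l).mp hl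
    have hr' : sm2 ∈ Rf D f := Subring.subset_closure (by simp)
    have hw' : (f : ℂ) * w D ∈ Rf D f := Subring.subset_closure (by simp)
    have hO' : ∀ i j : ℤ, (i : ℂ) + j * sm2 ∈ Rf D f := fun i j =>
      add_mem (intCast_mem _ i) (mul_mem (intCast_mem _ j) hr')
    convert add_mem (hO' m n') (mul_mem (hO' k' l') hw') using 1
    push_cast; ring
  · refine Subring.closure_le.mpr ?_
    rintro y (rfl | rfl)
    · exact hr
    · simpa using (hdvd f).mpr dvd_rfl
end
end
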